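/- Let k be a flexible field of characteristic zero and let π₁,…,π_s be finitely many anisotropic Pfister forms over k. Then there exists an anisotropic Pfister form π over k which is divisible by every π_l, i.e., for each l = 1,…,s there is a Pfister form τ_l over k such that π is isometric to the tensor product π_l ⊗ τ_l. (This is the quadratic-form formulation of the statement that over a flexible field any finite collection of non-zero pure symbols in Milnor K-theory modulo 2 admits a common non-zero pure-symbol multiple.) -/

import Mathlib

universe u

/-- A witness that the field `k` is flexible: a field `k₀` together with an isomorphism of `k`
with the purely transcendental extension `k₀(t₁,t₂,…)` of countably infinite degree. -/
structure FlexibleWitness (k : Type u) [Field k] : Type (u + 1) where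
  /-- the base field -/
  base : Type u
  [fieldBase : Field base]
  /-- the isomorphism of `k` with `base(t₁,t₂,…)` -/
  equiv : k ≃+* FractionRing (MvPolynomial ℕ base)

/-- A field `k` is flexible if it is a purely transcendental extension of countably infinite
transcendence degree of some field. -/
def IsFlexible (k : Type u) [Field k] : Prop :=
  Nonempty (FlexibleWitness k)

/-- The `r`-fold Pfister form `⟨⟨a₁,…,a_r⟩⟩ = ⟨1,−a₁⟩ ⊗ ⋯ ⊗ ⟨1,−a_r⟩` over `k`, written in its
standard diagonalization: the `2^r`-dimensional diagonal quadratic form whose entry at a subset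
`S ⊆ {1,…,r}` is `∏_{i ∈ S} (−a_i)`. -/
noncomputable def PfisterForm (k : Type u) [Field k] {r : ℕ} (a : Fin r → k) :
    QuadraticForm k (Finset (Fin r) → k) :=
  QuadraticMap.weightedSumSquares k fun S : Finset (Fin r) => ∏ i ∈ S, (-a i)

/-- In a field of characteristic zero, `2` is invertible. -/
noncomputable instance invertibleTwoOfCharZero (k : Type u) [Field k] [CharZero k] :
    Invertible (2 : k) :=
  invertibleOfNonzero two_ne_zero

/-- The diagonal quadratic form with coefficients `w i`, `i ∈ T`, is anisotropic. -/
def DiagAnisotropic {ι F : Type*} [Field F] (T : Finset ι) (w : ι → F) : Prop :=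
  ∀ v : ι → F, ∑ i ∈ T, w i * v i ^ 2 = 0 → ∀ i ∈ T, v i = 0

section Polynomial

open Polynomial

variable {ι F : Type*} [Field F] {T : Finset ι} {w : ι → F}

theorem coeff_two_mul_sum_mul_sq {p : ι → F[X]} {d : ℕ} (hp : ∀ i ∈ T, (p i).natDegree ≤ d) :
    (∑ i ∈ T, C (w i) * p i ^ 2).coeff (2 * d) = ∑ i ∈ T, w i * (p i).coeff d ^ 2 := by
  rw [finsetSum_coeff]
  refine Finset.sum_congr rfl fun i hi => ?_
  rw [coeff_C_mul, mul_comm 2 d, mul_comm d 2, coeff_pow_of_natDegree_le (hp i hi)]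

theorem DiagAnisotropic.natDegree_le (hw : DiagAnisotropic T w) {p : ι → F[X]} {n : ℕ}
    (h : (∑ i ∈ T, C (w i) * p i ^ 2).natDegree ≤ 2 * n) :
    ∀ i ∈ T, (p i).natDegree ≤ n := by
  by_contra! hcon
  obtain ⟨j, hj, hjn⟩ := hcon
  obtain ⟨m, hm, hmax⟩ := T.exists_max_image (fun i => (p i).natDegree) ⟨j, hj⟩
  have hlt : n < (p m).natDegree := hjn.trans_le (hmax j hj)
  have h0 := coeff_two_mul_sum_mul_sq (w := w) hmax
  rw [coeff_eq_zero_of_natDegree_lt (by omega)] at h0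
  have h1 : (p m).coeff (p m).natDegree = 0 := hw _ h0.symm m hm
  rw [coeff_natDegree, leadingCoeff_eq_zero] at h1
  simp [h1] at hlt

theorem DiagAnisotropic.polynomial (hw : DiagAnisotropic T w) {p : ι → F[X]}
    (h : ∑ i ∈ T, C (w i) * p i ^ 2 = 0) : ∀ i ∈ T, p i = 0 := by
  have hdeg : ∀ i ∈ T, (p i).natDegree ≤ 0 := hw.natDegree_le (by simp [h])
  have h0 := coeff_two_mul_sum_mul_sq (w := w) hdeg
  rw [h, coeff_zero] at h0
  intro i hi
  rw [eq_C_of_natDegree_le_zero (hdeg i hi), hw _ h0.symm i hi, C_0]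

/-- The Cassels–Pfister theorem for diagonal anisotropic forms. -/
theorem DiagAnisotropic.cassels_pfister (hw : DiagAnisotropic T w) {g : F[X]} {p : ι → F[X]}
    {f : F[X]} (hf : f ≠ 0) (h : ∑ i ∈ T, C (w i) * p i ^ 2 = g * f ^ 2) :
    ∃ q : ι → F[X], ∑ i ∈ T, C (w i) * q i ^ 2 = g := by
  induction hn : f.natDegree using Nat.strong_induction_on generalizing f p with
  | _ n ih =>
  subst hn
  set q : ι → F[X] := fun i => p i / f with hq
  set r : ι → F[X] := fun i => p i % f with hr
  have hpqr : ∀ i, p i = f * q i + r i := fun i => (EuclideanDomain.div_add_mod _ _).symm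
  by_cases hr0 : ∀ i ∈ T, r i = 0
  · refine ⟨q, mul_right_cancel₀ (pow_ne_zero 2 hf) ?_⟩
    rw [← h, Finset.sum_mul]
    refine Finset.sum_congr rfl fun i hi => ?_
    rw [hpqr i, hr0 i hi]
    ring
  · set A := ∑ i ∈ T, C (w i) * q i ^ 2 with hA
    set B := ∑ i ∈ T, C (w i) * (p i * q i) with hB
    have hPhir : ∑ i ∈ T, C (w i) * r i ^ 2 = f * (f * (A - g) - 2 * (B - g * f)) := by
      have h1 : ∑ i ∈ T, C (w i) * r i ^ 2
          = ∑ i ∈ T, C (w i) * p i ^ 2 - 2 * f * B + f ^ 2 * A := by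
        rw [hA, hB, Finset.mul_sum, Finset.mul_sum, ← Finset.sum_sub_distrib,
          ← Finset.sum_add_distrib]
        refine Finset.sum_congr rfl fun i _ => ?_
        rw [show r i = p i - f * q i from by rw [hpqr i]; ring]
        ring
      rw [h1, h]
      ring
    set f' := f * (A - g) - 2 * (B - g * f) with hf'
    have hne : ∑ i ∈ T, C (w i) * r i ^ 2 ≠ 0 := fun h0 => hr0 (hw.polynomial h0)
    have hf'0 : f' ≠ 0 := by
      rintro h0
      rw [h0, mul_zero] at hPhir
      exact hne hPhir
    have hfdeg : 0 < f.natDegree := by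
      rw [Nat.pos_iff_ne_zero]
      intro h0
      obtain ⟨c, hc⟩ := natDegree_eq_zero.1 h0
      refine hr0 fun i _ => ?_
      have hu : IsUnit f := by
        rw [← hc, isUnit_C, isUnit_iff_ne_zero]
        rintro rfl
        exact hf (by rw [← hc, C_0])
      exact (EuclideanDomain.mod_eq_zero).2 hu.dvd
    have hrdeg : ∀ i, (r i).natDegree ≤ f.natDegree - 1 := fun i => by
      have := natDegree_mod_lt (p i) hfdeg.ne'
      simp only [hr]
      omega
    have hlt : f'.natDegree < f.natDegree := by
      have h1 : (∑ i ∈ T, C (w i) * r i ^ 2).natDegree ≤ 2 * (f.natDegree - 1) := by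
        refine natDegree_sum_le_of_forall_le _ _ fun i _ => ?_
        refine (natDegree_C_mul_le _ _).trans ?_
        rw [natDegree_pow]
        exact Nat.mul_le_mul_left _ (hrdeg i)
      rw [hPhir, natDegree_mul hf hf'0] at h1
      omega
    refine ih _ hlt (f := f') (p := fun i => (A - g) * p i - 2 * (B - g * f) * q i) hf'0 ?_ rfl
    have h2 : ∑ i ∈ T, C (w i) * ((A - g) * p i - 2 * (B - g * f) * q i) ^ 2
        = (A - g) ^ 2 * ∑ i ∈ T, C (w i) * p i ^ 2 - 4 * (A - g) * (B - g * f) * B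
          + 4 * (B - g * f) ^ 2 * A := by
      conv_rhs => rw [hA]
      conv_rhs => enter [1, 2]; rw [hB]
      rw [Finset.mul_sum, Finset.mul_sum, Finset.mul_sum, ← Finset.sum_sub_distrib,
          ← Finset.sum_add_distrib]
      refine Finset.sum_congr rfl fun i _ => ?_
      ring
    rw [h2, h, hf']
    ring

/-- If `∑ i ∈ T, w i * X i ^ 2` does not represent `b`, then after adding the entry `w i` it does
not represent `b + w i * X ^ 2` over the polynomial ring. -/
theorem DiagAnisotropic.not_represents_polynomial [DecidableEq ι] (h2 : (2 : F) ≠ 0) {i : ι}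
    (hi : i ∉ T)
    (hw : DiagAnisotropic (insert i T) w) {b : F} (hb : ∀ v : ι → F, ∑ j ∈ T, w j * v j ^ 2 ≠ b)
    (p : ι → F[X]) : ∑ j ∈ insert i T, C (w j) * p j ^ 2 ≠ C b + C (w i) * X ^ 2 := by
  intro h
  have hdeg : (p i).natDegree ≤ 1 := by
    refine hw.natDegree_le (n := 1) ?_ i (Finset.mem_insert_self i T)
    rw [h]
    compute_degree
  obtain ⟨β, α, hp⟩ := exists_eq_X_add_C_of_natDegree_le_one hdeg
  obtain ⟨ε, hε, hne⟩ : ∃ ε : F, ε ^ 2 = 1 ∧ ε - β ≠ 0 := by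
    by_cases h1 : (1 : F) - β = 0
    · refine ⟨-1, by norm_num, fun h3 => h2 ?_⟩
      linear_combination h1 - h3
    · exact ⟨1, by norm_num, h1⟩
  set c := α / (ε - β)
  have hc : (p i).eval c = ε * c := by
    have : c * (ε - β) = α := div_mul_cancel₀ _ hne
    rw [hp]
    simp only [eval_add, eval_mul, eval_C, eval_X]
    linear_combination -this
  have := congrArg (eval c) h
  rw [Finset.sum_insert hi] at this
  simp only [eval_add, eval_mul, eval_C, eval_pow, eval_finsetSum, eval_X, hc] at this
  refine hb (fun j => (p j).eval c) ?_
  linear_combination this - w i * c ^ 2 * hε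

end Polynomial

section Transcendental

variable {ι F K : Type*} [Field F] [Field K] [Algebra F K] {T : Finset ι} {w : ι → F} {x : K}

open IntermediateField Polynomial

theorem exists_common_denominator (T : Finset ι) {v : ι → K} (hv : ∀ i, v i ∈ F⟮x⟯) :
    ∃ (f : F[X]) (p : ι → F[X]), aeval x f ≠ 0 ∧ ∀ i ∈ T, v i * aeval x f = aeval x (p i) := by
  classical
  choose r s hrs using fun i => (mem_adjoin_simple_iff F (v i)).1 (hv i)
  set s' : ι → F[X] := fun i => if aeval x (s i) = 0 then 1 else s i with hs'
  have hs0 : ∀ i, aeval x (s' i) ≠ 0 := fun i => by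
    by_cases h : aeval x (s i) = 0 <;> simp [hs', h]
  have hv' : ∀ i, ∃ r', v i * aeval x (s' i) = aeval x r' := fun i => by
    by_cases h : aeval x (s i) = 0
    · exact ⟨0, by simp [hrs i, h]⟩
    · exact ⟨r i, by simp [hs', hrs i, h]⟩
  choose r' hr' using hv'
  refine ⟨∏ i ∈ T, s' i, fun i => r' i * ∏ j ∈ T.erase i, s' j, ?_, fun i hi => ?_⟩
  · rw [map_prod]
    exact Finset.prod_ne_zero_iff.2 fun i _ => hs0 i
  · rw [← Finset.mul_prod_erase T s' hi, map_mul, map_mul, ← hr' i]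
    ring

theorem aeval_sum_mul_sq (p : ι → F[X]) : aeval x (∑ i ∈ T, C (w i) * p i ^ 2)
    = ∑ i ∈ T, algebraMap F K (w i) * aeval x (p i) ^ 2 := by
  simp

theorem DiagAnisotropic.adjoin_transcendental (hx : Transcendental F x) (hw : DiagAnisotropic T w)
    {v : ι → K} (hv : ∀ i, v i ∈ F⟮x⟯) (h : ∑ i ∈ T, algebraMap F K (w i) * v i ^ 2 = 0) :
    ∀ i ∈ T, v i = 0 := by
  obtain ⟨f, p, hf, hp⟩ := exists_common_denominator T hv
  have h0 : aeval x (∑ i ∈ T, C (w i) * p i ^ 2) = 0 := by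
    rw [aeval_sum_mul_sq, ← zero_mul (aeval x f ^ 2), ← h, Finset.sum_mul]
    refine Finset.sum_congr rfl fun i hi => ?_
    rw [← hp i hi]
    ring
  have h1 := hw.polynomial ((transcendental_iff.1 hx) _ h0)
  intro i hi
  have := hp i hi
  rw [h1 i hi, map_zero] at this
  exact (mul_eq_zero.1 this).resolve_right hf

theorem DiagAnisotropic.not_represents_adjoin [DecidableEq ι] (h2 : (2 : F) ≠ 0)
    (hx : Transcendental F x) {i : ι} (hi : i ∉ T) (hw : DiagAnisotropic (insert i T) w) {b : F}
    (hb : ∀ v : ι → F, ∑ j ∈ T, w j * v j ^ 2 ≠ b) {v : ι → K} (hv : ∀ i, v i ∈ F⟮x⟯) :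
    ∑ j ∈ insert i T, algebraMap F K (w j) * v j ^ 2
      ≠ algebraMap F K b + algebraMap F K (w i) * x ^ 2 := by
  intro h
  obtain ⟨f, p, hf, hp⟩ := exists_common_denominator (insert i T) hv
  have hpol : ∑ j ∈ insert i T, C (w j) * p j ^ 2 = (C b + C (w i) * X ^ 2) * f ^ 2 := by
    rw [← sub_eq_zero]
    refine (transcendental_iff.1 hx) _ ?_
    rw [map_sub, sub_eq_zero, aeval_sum_mul_sq]
    simp only [map_mul, map_add, map_pow, aeval_C, aeval_X]
    rw [← h, Finset.sum_mul]
    refine Finset.sum_congr rfl fun i hi => ?_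
    rw [← hp i hi]
    ring
  have hf0 : f ≠ 0 := by
    rintro rfl
    simp at hf
  obtain ⟨q, hq⟩ := hw.cassels_pfister hf0 hpol
  exact hw.not_represents_polynomial h2 hi hb q hq

end Transcendental

section Stage

open IntermediateField

variable {k₀ k : Type*} [Field k₀] [Field k] [Algebra k₀ k]

/-- The subfield `k₀(x₀, …, x_{n-1})` of `k`. -/
def stage (k₀ : Type*) {k : Type*} [Field k₀] [Field k] [Algebra k₀ k] (x : ℕ → k) (n : ℕ) :
    IntermediateField k₀ k :=
  adjoin k₀ (x '' {i | i < n})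

variable {x : ℕ → k}

theorem stage_mono : Monotone (stage k₀ x) := fun _ _ h =>
  adjoin.mono _ _ _ (Set.image_mono fun _ hi => lt_of_lt_of_le hi h)

theorem mem_stage_succ (n : ℕ) : x n ∈ stage k₀ x (n + 1) :=
  subset_adjoin _ _ ⟨n, Nat.lt_succ_self n, rfl⟩

theorem transcendental_stage (hx : AlgebraicIndependent k₀ x) (n : ℕ) :
    Transcendental (stage k₀ x n) (x n) :=
  transcendental_adjoin_iff.2 (hx.transcendental_adjoin (by simp))

theorem mem_adjoin_of_mem_stage_succ {n : ℕ} {y : k} (hy : y ∈ stage k₀ x (n + 1)) :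
    y ∈ (stage k₀ x n)⟮x n⟯ := by
  have h : stage k₀ x (n + 1) ≤ (stage k₀ x n)⟮x n⟯.restrictScalars k₀ := by
    refine adjoin_le_iff.2 ?_
    rintro _ ⟨i, hi, rfl⟩
    refine (mem_restrictScalars k₀).2 ?_
    rcases Nat.lt_succ_iff_lt_or_eq.1 hi with h | rfl
    · have hxi : x i ∈ stage k₀ x n := subset_adjoin _ _ ⟨i, h, rfl⟩
      exact IntermediateField.algebraMap_mem _ (⟨x i, hxi⟩ : stage k₀ x n)
    · exact mem_adjoin_simple_self _ _
  exact (mem_restrictScalars k₀).1 (h hy)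

theorem exists_mem_stage (htop : adjoin k₀ (Set.range x) = ⊤) (y : k) : ∃ n, y ∈ stage k₀ x n := by
  have h : adjoin k₀ (Set.range x) ≤ ⨆ n, stage k₀ x n := by
    refine adjoin_le_iff.2 ?_
    rintro _ ⟨i, rfl⟩
    exact le_iSup (stage k₀ x) (i + 1) (mem_stage_succ i)
  have hy : y ∈ ⨆ n, stage k₀ x n := h (htop ▸ mem_top)
  have := coe_iSup_of_directed (t := stage k₀ x) stage_mono.directed_le
  rw [← SetLike.mem_coe, this] at hy
  simpa using hy

theorem exists_forall_mem_stage (htop : adjoin k₀ (Set.range x) = ⊤) {ι : Type*} [Finite ι]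
    (v : ι → k) : ∃ n, ∀ i, v i ∈ stage k₀ x n := by
  choose n hn using fun i => exists_mem_stage htop (v i)
  obtain ⟨N, hN⟩ := (Set.finite_range n).bddAbove
  exact ⟨N, fun i => stage_mono (hN ⟨i, rfl⟩) (hn i)⟩

variable {ι : Type*} {w : ι → k} {n : ℕ}

/-- A diagonal form over `k₀(x₀, …, x_{n-1})` which is anisotropic over that field stays so
over `k`. -/
theorem diagAnisotropic_of_stage [Finite ι] (hx : AlgebraicIndependent k₀ x)
    (htop : adjoin k₀ (Set.range x) = ⊤) {T : Finset ι} (hw : ∀ i, w i ∈ stage k₀ x n)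
    (h : ∀ v : ι → k, (∀ i, v i ∈ stage k₀ x n) → ∑ i ∈ T, w i * v i ^ 2 = 0 → ∀ i ∈ T, v i = 0) :
    DiagAnisotropic T w := by
  have key : ∀ m, n ≤ m → ∀ v : ι → k, (∀ i, v i ∈ stage k₀ x m) →
      ∑ i ∈ T, w i * v i ^ 2 = 0 → ∀ i ∈ T, v i = 0 := by
    intro m hm
    induction m, hm using Nat.le_induction with
    | base => exact h
    | succ m hm ih =>
      intro v hv
      refine DiagAnisotropic.adjoin_transcendental (F := stage k₀ x m)
        (w := fun i => ⟨w i, stage_mono hm (hw i)⟩) (transcendental_stage hx m) ?_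
        fun i => mem_adjoin_of_mem_stage_succ (hv i)
      intro u hu i hi
      refine Subtype.ext (ih (fun i => u i) (fun i => (u i).2) ?_ i hi)
      simpa using congrArg (algebraMap (stage k₀ x m) k) hu
  intro v hv
  obtain ⟨N, hN⟩ := exists_forall_mem_stage htop v
  exact key (max n N) (le_max_left _ _) v (fun i => stage_mono (le_max_right _ _) (hN i)) hv

theorem not_represents_stage_succ [CharZero k] [DecidableEq ι] (hx : AlgebraicIndependent k₀ x)
    {T : Finset ι} {i : ι} (hi : i ∉ T) (hw : ∀ i, w i ∈ stage k₀ x n)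
    (ha : DiagAnisotropic (insert i T) w) {b : k} (hbn : b ∈ stage k₀ x n)
    (hb : ∀ v : ι → k, (∀ i, v i ∈ stage k₀ x n) → ∑ j ∈ T, w j * v j ^ 2 ≠ b) :
    ∀ v : ι → k, (∀ i, v i ∈ stage k₀ x (n + 1)) →
      ∑ j ∈ insert i T, w j * v j ^ 2 ≠ b + w i * x n ^ 2 := by
  intro v hv
  refine DiagAnisotropic.not_represents_adjoin (F := stage k₀ x n)
    (w := fun i => ⟨w i, hw i⟩) (b := ⟨b, hbn⟩) (fun h => ?_) (transcendental_stage hx n) hi ?_ ?_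
    fun i => mem_adjoin_of_mem_stage_succ (hv i)
  · have h' := congrArg (algebraMap (stage k₀ x n) k) h
    simp at h'
  · intro u hu i hi
    refine Subtype.ext (ha (fun i => u i) ?_ i hi)
    simpa using congrArg (algebraMap (stage k₀ x n) k) hu
  · intro u hu
    refine hb (fun i => u i) (fun i => (u i).2) ?_
    simpa using congrArg (algebraMap (stage k₀ x n) k) hu

/-- Given disjoint `S` and `T` such that the part of an anisotropic diagonal form indexed by `S`
does not represent `b`, a generic translate of `b` by the part indexed by `T` is not represented by
the part indexed by `S ∪ T`. -/
theorem exists_not_represents_union [CharZero k] [DecidableEq ι] (hx : AlgebraicIndependent k₀ x)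
    {S T : Finset ι} (hST : Disjoint S T) (hw : ∀ i, w i ∈ stage k₀ x n)
    (ha : DiagAnisotropic (S ∪ T) w) {b : k} (hbn : b ∈ stage k₀ x n)
    (hb : ∀ v : ι → k, (∀ i, v i ∈ stage k₀ x n) → ∑ j ∈ S, w j * v j ^ 2 ≠ b) :
    ∃ m, n ≤ m ∧ ∃ u : ι → k, (∀ i, u i ∈ stage k₀ x m) ∧
      ∀ v : ι → k, (∀ i, v i ∈ stage k₀ x m) →
        ∑ j ∈ S ∪ T, w j * v j ^ 2 ≠ b + ∑ j ∈ T, w j * u j ^ 2 := by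
  induction T using Finset.induction_on with
  | empty => exact ⟨n, le_rfl, 0, fun _ => zero_mem _, by simpa using hb⟩
  | insert i T hi ih =>
    rw [Finset.disjoint_insert_right] at hST
    rw [Finset.union_insert] at ha ⊢
    have ha' : DiagAnisotropic (S ∪ T) w := by
      intro v hv j hj
      have hne : ∀ j ∈ S ∪ T, j ≠ i := fun j hj h => by
        subst h
        simp [hi, hST.1] at hj
      have hsum : ∑ j ∈ insert i (S ∪ T), w j * Function.update v i 0 j ^ 2 = 0 := by
        rw [Finset.sum_insert (by simp [hi, hST.1]), Function.update_self, zero_pow two_ne_zero,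
          mul_zero, zero_add]
        refine (Finset.sum_congr rfl fun j hj => ?_).trans hv
        rw [Function.update_of_ne (hne j hj)]
      have := ha _ hsum j (Finset.mem_insert_of_mem hj)
      rwa [Function.update_of_ne (hne j hj)] at this
    obtain ⟨m, hm, u, hu, h⟩ := ih hST.2 ha'
    have hw' : ∀ i, w i ∈ stage k₀ x m := fun i => stage_mono hm (hw i)
    refine ⟨m + 1, hm.trans m.le_succ, Function.update u i (x m), fun j => ?_, ?_⟩
    · rcases eq_or_ne j i with rfl | hj
      · simpa using mem_stage_succ m
      · simpa [hj] using stage_mono m.le_succ (hu j)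
    · have h' := not_represents_stage_succ hx (by simp [hi, hST.1]) hw' ha
        (add_mem (stage_mono hm hbn) (sum_mem fun j _ => mul_mem (hw' j) (pow_mem (hu j) 2))) h
      intro v hv hcon
      refine h' v hv (hcon.trans ?_)
      rw [Finset.sum_insert hi, Function.update_self, Finset.sum_congr rfl fun j hj => by
        rw [Function.update_of_ne (ne_of_mem_of_not_mem hj hi)]]
      ring

end Stage

section Forms

open QuadraticMap

variable {k M M' M₁ M₂ M₃ M₄ : Type*} [Field k] [AddCommGroup M] [Module k M] [AddCommGroup M']
  [Module k M'] [AddCommGroup M₁] [Module k M₁] [AddCommGroup M₂] [Module k M₂]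
  [AddCommGroup M₃] [Module k M₃] [AddCommGroup M₄] [Module k M₄]
  {Q : QuadraticForm k M} {Q' : QuadraticForm k M'}

theorem QuadraticMap.Equivalent.smul (c : k) (h : Q.Equivalent Q') :
    (c • Q).Equivalent (c • Q') :=
  h.elim fun e => ⟨{
    e.toLinearEquiv with
    map_app' := fun m => congrArg (c * ·) (e.map_app m) }⟩

theorem QuadraticMap.equivalent_sq_smul (Q : QuadraticForm k M) {c : k} (hc : c ≠ 0) :
    ((c * c) • Q).Equivalent Q :=
  ⟨{
    LinearEquiv.smulOfNeZero k M c hc with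
    map_app' := fun m => QuadraticMap.map_smul Q c m }⟩

theorem QuadraticMap.Equivalent.anisotropic (h : Q.Equivalent Q') (hQ : Q.Anisotropic) :
    Q'.Anisotropic := by
  obtain ⟨e⟩ := h.symm
  intro v hv
  have := hQ (e v) (by rw [e.map_app, hv])
  simpa using this

theorem QuadraticMap.smul_prod (c : k) (Q₁ : QuadraticForm k M₁) (Q₂ : QuadraticForm k M₂) :
    c • Q₁.prod Q₂ = (c • Q₁).prod (c • Q₂) := by
  ext v
  simp [mul_add]

/-- The change of variables relating `⟨c, d⟩` and `⟨c + d, c d (c + d)⟩`. -/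
theorem QuadraticMap.equivalent_prod_add (Q : QuadraticForm k M) {c d : k} (h : c + d ≠ 0) :
    ((c • Q).prod (d • Q)).Equivalent (((c + d) • Q).prod ((c * d * (c + d)) • Q)) := by
  refine Equivalent.symm ⟨{
    toFun := fun p => (p.1 + d • p.2, p.1 - c • p.2)
    invFun := fun p => ((c + d)⁻¹ • (c • p.1 + d • p.2), (c + d)⁻¹ • (p.1 - p.2))
    map_add' := fun p q => by ext <;> simp <;> module
    map_smul' := fun r p => by ext <;> simp <;> module
    left_inv := fun p => ?_
    right_inv := fun p => ?_
    map_app' := fun p => ?_ }⟩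
  · ext
    · rw [← sub_eq_zero]
      match_scalars <;> field_simp <;> ring
    · rw [← sub_eq_zero]
      match_scalars <;> field_simp <;> ring
  · ext
    · rw [← sub_eq_zero]
      match_scalars <;> field_simp <;> ring
    · rw [← sub_eq_zero]
      match_scalars <;> field_simp <;> ring
  · have h1 : Q (p.1 + d • p.2) = Q p.1 + d * d * Q p.2 + d * polar Q p.1 p.2 := by
      rw [QuadraticMap.map_add Q, QuadraticMap.map_smul, polar_smul_right, smul_eq_mul, smul_eq_mul]
    have h2 : Q (p.1 - c • p.2) = Q p.1 + c * c * Q p.2 - c * polar Q p.1 p.2 := by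
      rw [sub_eq_add_neg, ← neg_smul, QuadraticMap.map_add Q, QuadraticMap.map_smul,
        polar_smul_right, smul_eq_mul, smul_eq_mul]
      ring
    simp only [prod_apply, smul_apply, smul_eq_mul, h1, h2]
    ring

theorem QuadraticMap.equivalent_prod_prod_rotate (Q₁ : QuadraticForm k M₁)
    (Q₂ : QuadraticForm k M₂) (Q₃ : QuadraticForm k M₃) (Q₄ : QuadraticForm k M₄) :
    ((Q₁.prod Q₂).prod (Q₃.prod Q₄)).Equivalent ((Q₁.prod Q₄).prod (Q₂.prod Q₃)) :=
  ⟨{  toFun := fun p => ((p.1.1, p.2.2), (p.1.2, p.2.1))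
      invFun := fun p => ((p.1.1, p.2.1), (p.2.2, p.1.2))
      map_add' := fun _ _ => rfl
      map_smul' := fun _ _ => rfl
      left_inv := fun _ => rfl
      right_inv := fun _ => rfl
      map_app' := fun p => by simp only [prod_apply]; ring }⟩

/-- The form `⟨1, -a⟩ ⊗ Q`. -/
abbrev QuadraticMap.double (a : k) (Q : QuadraticForm k M) : QuadraticForm k (M × M) :=
  Q.prod ((-a) • Q)

theorem QuadraticMap.double_apply (a : k) (Q : QuadraticForm k M) (p : M × M) :
    double a Q p = Q p.1 - a * Q p.2 := by
  simp [double, sub_eq_add_neg]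

theorem QuadraticMap.Equivalent.double (a : k) (h : Q.Equivalent Q') :
    (double a Q).Equivalent (double a Q') :=
  h.prod (h.smul _)

theorem QuadraticMap.double_comm (a b : k) (Q : QuadraticForm k M) :
    (double a (double b Q)).Equivalent (double b (double a Q)) :=
  ⟨{  toFun := fun p => ((p.1.1, p.2.1), (p.1.2, p.2.2))
      invFun := fun p => ((p.1.1, p.2.1), (p.1.2, p.2.2))
      map_add' := fun _ _ => rfl
      map_smul' := fun _ _ => rfl
      left_inv := fun _ => rfl
      right_inv := fun _ => rfl
      map_app' := fun p => by simp only [double_apply]; ring }⟩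

/-- The identity `{c, d} = {c + d, -cd}` for Pfister forms. -/
theorem QuadraticMap.double_double_add (Q : QuadraticForm k M) {c d : k} (h : c + d ≠ 0) :
    (double c (double d Q)).Equivalent (double (c + d) (double (-(c * d)) Q)) := by
  have h' : -d + -c ≠ 0 := fun h0 => h (by linear_combination -h0)
  have h1 := equivalent_prod_prod_rotate Q ((-d) • Q) ((-c) • Q) ((-c) • (-d) • Q)
  have h2 := (Equivalent.refl (Q.prod ((-c) • (-d) • Q))).prod (equivalent_prod_add Q h')
  rw [double, double, smul_prod]
  refine (h1.trans h2).trans ?_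
  rw [double, double, smul_prod, smul_smul, smul_smul, show -c * -d = -(-(c * d)) by ring,
    show -d + -c = -(c + d) by ring,
    show -d * -c * -(c + d) = -(c + d) * -(-(c * d)) by ring]

/-- A form is round if every non-zero value is a similarity factor. -/
def QuadraticMap.IsRound (Q : QuadraticForm k M) : Prop :=
  ∀ v, Q v ≠ 0 → (Q v • Q).Equivalent Q

theorem QuadraticMap.IsRound.of_equivalent (h : Q.Equivalent Q') (hQ : Q.IsRound) :
    Q'.IsRound := by
  intro v hv
  obtain ⟨e⟩ := h.symm
  rw [← e.map_app] at hv ⊢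
  exact ((h.symm.smul _).trans (hQ _ hv)).trans h

theorem QuadraticMap.IsRound.equivalent_double_mul (hQ : Q.IsRound) (a : k) {v : M} (hv : Q v ≠ 0) :
    (double a Q).Equivalent (double (a * Q v) Q) := by
  have := (Equivalent.refl Q).prod ((hQ v hv).symm.smul (-a))
  rwa [smul_smul, neg_mul] at this

theorem QuadraticMap.isRound_double (hQ : Q.IsRound) {a : k} (ha : a ≠ 0) :
    (double a Q).IsRound := by
  intro p hp
  rw [double_apply] at hp ⊢
  by_cases h1 : Q p.2 = 0
  · rw [h1, mul_zero, sub_zero] at hp ⊢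
    rw [smul_prod, smul_comm]
    exact (hQ _ hp).prod ((hQ _ hp).smul _)
  by_cases h0 : Q p.1 = 0
  · have h2 : (Q p.2 • double a Q).Equivalent (double a Q) := by
      rw [smul_prod, smul_comm]
      exact (hQ _ h1).prod ((hQ _ h1).smul _)
    have h3 : ((-a) • double a Q).Equivalent (double a Q) := by
      rw [smul_prod, smul_smul]
      exact (Equivalent.refl _ |>.prod (equivalent_sq_smul Q (neg_ne_zero.2 ha))).trans
        ⟨IsometryEquiv.prodComm _ _⟩
    rw [h0, zero_sub, ← neg_mul, ← smul_smul]
    exact (h2.smul _).trans h3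
  · set c := Q p.1
    set d := -(a * Q p.2)
    have hd : (c • Q).prod (d • Q) = (c • Q).prod ((-a) • Q p.2 • Q) := by
      rw [smul_smul, neg_mul]
    have e1 : ((c • Q).prod (d • Q)).Equivalent (double a Q) := by
      rw [hd]
      exact (hQ _ h0).prod ((hQ _ h1).smul _)
    rw [sub_eq_add_neg] at hp ⊢
    have e2 := e1.symm.trans (equivalent_prod_add Q hp)
    refine Equivalent.symm (e2.trans ?_)
    rw [smul_prod]
    refine (Equivalent.refl _).prod ?_
    have e3 : (c • Q p.2 • Q).Equivalent Q := ((hQ _ h1).smul c).trans (hQ _ h0)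
    convert e3.smul ((c + d) * -a) using 1
    · rw [smul_smul, smul_smul]
      congr 1
      simp only [d]
      ring
    · rw [smul_smul]

theorem QuadraticMap.IsRound.anisotropic_double (hQ : Q.IsRound) (ha : Q.Anisotropic) {t : k}
    (ht : ∀ v, Q v ≠ t) : (QuadraticMap.double t Q).Anisotropic := by
  rintro ⟨v, u⟩ h
  rw [double_apply] at h
  by_cases hu : Q u = 0
  · rw [hu, mul_zero, sub_zero] at h
    rw [ha v h, ha u hu, Prod.mk_zero_zero]
  · obtain ⟨e⟩ := hQ u hu
    refine absurd ?_ (ht ((Q u)⁻¹ • e v))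
    rw [QuadraticMap.map_smul, e.map_app, smul_apply, smul_eq_mul, smul_eq_mul,
      show Q v = t * Q u from sub_eq_zero.1 h]
    field_simp

theorem QuadraticMap.Anisotropic.of_double {a : k} (h : (QuadraticMap.double a Q).Anisotropic) :
    Q.Anisotropic := by
  intro v hv
  have := h (v, 0) (by rw [double_apply]; simp [hv])
  exact (Prod.mk.inj this).1

theorem QuadraticMap.Anisotropic.ne_of_double {a : k} (h : (QuadraticMap.double a Q).Anisotropic)
    {v : M} (hv : Q v = 1) (u : M) : Q u ≠ a := by
  intro hu
  have := h (u, v) (by rw [double_apply, hv, hu]; simp)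
  rw [(Prod.mk.inj this).2, QuadraticMap.map_zero] at hv
  exact zero_ne_one hv

end Forms

section PfisterList

open QuadraticMap

/-- The index type of the diagonal Pfister form attached to a list. -/
def PfisterIndex {α : Type*} : List α → Type
  | [] => Unit
  | _ :: l => PfisterIndex l ⊕ PfisterIndex l

instance PfisterIndex.fintype {α : Type*} : (l : List α) → Fintype (PfisterIndex l)
  | [] => inferInstanceAs (Fintype Unit)
  | _ :: l =>
    have := PfisterIndex.fintype l
    inferInstanceAs (Fintype (PfisterIndex l ⊕ PfisterIndex l))

variable {k : Type*} [Field k]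

/-- The diagonal entries of the Pfister form attached to a list. -/
def pfisterWeight : (l : List k) → PfisterIndex l → k
  | [] => fun _ => 1
  | a :: l => Sum.elim (pfisterWeight l) fun i => -a * pfisterWeight l i

/-- The Pfister form `⟨1, -a₁⟩ ⊗ ⋯ ⊗ ⟨1, -a_r⟩` attached to the list `[a₁, …, a_r]`. -/
noncomputable def listPfister (l : List k) : QuadraticForm k (PfisterIndex l → k) :=
  weightedSumSquares k (pfisterWeight l)

theorem listPfister_apply (l : List k) (v : PfisterIndex l → k) :
    listPfister l v = ∑ i, pfisterWeight l i * v i ^ 2 := by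
  simp [listPfister, weightedSumSquares_apply, pow_two]

theorem listPfister_nil_apply (v : PfisterIndex ([] : List k) → k) :
    listPfister [] v = v () ^ 2 := by
  rw [listPfister_apply]
  refine (Fintype.sum_unique (ι := Unit) _).trans ?_
  simp only [pfisterWeight, one_mul]

theorem anisotropic_listPfister_iff {l : List k} :
    (listPfister l).Anisotropic ↔ DiagAnisotropic Finset.univ (pfisterWeight l) := by
  simp only [Anisotropic, DiagAnisotropic, listPfister_apply, funext_iff, Finset.mem_univ,
    true_imp_iff, Pi.zero_apply]

theorem listPfister_cons (a : k) (l : List k) :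
    (listPfister (a :: l)).Equivalent (double a (listPfister l)) := by
  refine ⟨{ LinearEquiv.sumArrowLequivProdArrow (PfisterIndex l) (PfisterIndex l) k k with
    map_app' := fun v => ?_ }⟩
  rw [double_apply, listPfister_apply, listPfister_apply, listPfister_apply]
  refine Eq.trans ?_ (Fintype.sum_sum_type (α₁ := PfisterIndex l) (α₂ := PfisterIndex l)
    fun i => pfisterWeight (a :: l) i * v i ^ 2).symm
  simp [pfisterWeight, Finset.mul_sum, sub_eq_add_neg, mul_assoc]
  rfl

theorem listPfister_cons_congr (a : k) {l l' : List k}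
    (h : (listPfister l).Equivalent (listPfister l')) :
    (listPfister (a :: l)).Equivalent (listPfister (a :: l')) :=
  ((listPfister_cons a l).trans (h.double a)).trans (listPfister_cons a l').symm

theorem listPfister_cons_cons (a b : k) (l : List k) :
    (listPfister (a :: b :: l)).Equivalent (double a (double b (listPfister l))) :=
  (listPfister_cons a _).trans ((listPfister_cons b l).double a)

theorem listPfister_perm {l l' : List k} (h : l.Perm l') :
    (listPfister l).Equivalent (listPfister l') := by
  induction h with
  | nil => exact Equivalent.refl _
  | cons a _ ih => exact listPfister_cons_congr a ih
  | swap a b l =>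
    exact ((listPfister_cons_cons b a l).trans (double_comm b a _)).trans
      (listPfister_cons_cons a b l).symm
  | trans _ _ ih₁ ih₂ => exact ih₁.trans ih₂

theorem exists_listPfister_eq_one : (l : List k) → ∃ v, listPfister l v = 1
  | [] => ⟨fun _ => 1, by rw [listPfister_nil_apply, one_pow]⟩
  | a :: l => by
    obtain ⟨v, hv⟩ := exists_listPfister_eq_one l
    obtain ⟨e⟩ := (listPfister_cons a l).symm
    exact ⟨e (v, 0), by rw [e.map_app, double_apply, hv]; simp⟩

theorem isRound_listPfister : {l : List k} → (0 : k) ∉ l → (listPfister l).IsRound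
  | [], _ => by
    intro v hv
    rw [listPfister_nil_apply, pow_two] at hv ⊢
    exact equivalent_sq_smul _ (left_ne_zero_of_mul hv)
  | a :: l, h => by
    rw [List.mem_cons, not_or] at h
    exact IsRound.of_equivalent (listPfister_cons a l).symm
      (isRound_double (isRound_listPfister h.2) (Ne.symm h.1))

/-- The values on the form indexed by `r ++ s` that come from vectors orthogonal to the form
indexed by `s`, up to sign. -/
def PureValue (s : List k) : List k → k → Prop
  | [], y => y = 0
  | a :: r, y => ∃ y₀ v, PureValue s r y₀ ∧ y = y₀ + a * listPfister (r ++ s) v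

theorem PureValue.exists_equivalent {s r : List k} {y : k} (hs : (0 : k) ∉ s) (hr : (0 : k) ∉ r)
    (h : PureValue s r y) (hy : y ≠ 0) :
    ∃ r', (0 : k) ∉ r' ∧ (listPfister (r ++ s)).Equivalent (listPfister (r' ++ y :: s)) := by
  induction r generalizing y with
  | nil => exact absurd h hy
  | cons a r ih =>
    obtain ⟨y₀, v, h, rfl⟩ := h
    rw [List.mem_cons, not_or] at hr
    by_cases hv : listPfister (r ++ s) v = 0
    · rw [hv, mul_zero, add_zero] at hy ⊢
      obtain ⟨r', hr', h'⟩ := ih hr.2 h hy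
      exact ⟨a :: r', by simp [hr.1, hr'], listPfister_cons_congr a h'⟩
    have hrs : (0 : k) ∉ r ++ s := by simp [hr.2, hs]
    have hav : a * listPfister (r ++ s) v ≠ 0 := mul_ne_zero (Ne.symm hr.1) hv
    have h1 : (listPfister (a :: r ++ s)).Equivalent
        (listPfister (a * listPfister (r ++ s) v :: (r ++ s))) :=
      ((listPfister_cons _ _).trans ((isRound_listPfister hrs).equivalent_double_mul a hv)).trans
        (listPfister_cons _ _).symm
    set c := a * listPfister (r ++ s) v
    by_cases h0 : y₀ = 0
    · rw [h0, zero_add]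
      exact ⟨r, hr.2, h1.trans (listPfister_perm List.perm_middle.symm)⟩
    · obtain ⟨r', hr', h'⟩ := ih hr.2 h h0
      refine ⟨-(c * y₀) :: r', by simp [hr', hav, h0], ?_⟩
      have h2 := listPfister_cons_congr c (h'.trans (listPfister_perm List.perm_middle))
      rw [add_comm] at hy ⊢
      have h3 := ((listPfister_cons_cons c y₀ (r' ++ s)).trans (double_double_add _ hy)).trans
        (listPfister_cons_cons _ _ _).symm
      exact ((h1.trans h2).trans h3).trans
        (listPfister_perm (List.perm_middle (l₁ := -(c * y₀) :: r')).symm)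

end PfisterList

section CommonMultiple

open QuadraticMap IntermediateField

variable {k₀ k : Type*} [Field k₀] [Field k] [Algebra k₀ k] {x : ℕ → k}

theorem pfisterWeight_mem {F : Subfield k} {l : List k} (h : ∀ a ∈ l, a ∈ F) (i : PfisterIndex l) :
    pfisterWeight l i ∈ F := by
  induction l with
  | nil => exact one_mem F
  | cons a l ih =>
    rw [List.forall_mem_cons] at h
    cases i with
    | inl i => exact ih h.2 i
    | inr i => exact mul_mem (neg_mem h.1) (ih h.2 i)

theorem exists_not_represents_sumElim [CharZero k] (hx : AlgebraicIndependent k₀ x)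
    {ι κ : Type*} [Fintype ι] [Fintype κ] {n : ℕ} {w : ι ⊕ κ → k} (hw : ∀ i, w i ∈ stage k₀ x n)
    (ha : DiagAnisotropic Finset.univ w) {b : k} (hbn : b ∈ stage k₀ x n)
    (hb : ∀ v : ι → k, (∀ i, v i ∈ stage k₀ x n) → ∑ j, w (.inl j) * v j ^ 2 ≠ b) :
    ∃ m, n ≤ m ∧ ∃ u : κ → k, (∀ i, u i ∈ stage k₀ x m) ∧
      ∀ v : ι ⊕ κ → k, (∀ i, v i ∈ stage k₀ x m) →
        ∑ j, w j * v j ^ 2 ≠ b + ∑ j, w (.inr j) * u j ^ 2 := by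
  classical
  have hun : (Finset.univ.map .inl ∪ Finset.univ.map .inr : Finset (ι ⊕ κ)) = Finset.univ := by
    ext i
    cases i <;> simp
  have hdis : Disjoint (Finset.univ.map .inl) (Finset.univ.map .inr : Finset (ι ⊕ κ)) := by
    simp [Finset.disjoint_left]
  rw [← hun] at ha
  obtain ⟨m, hm, u, hu, h⟩ := exists_not_represents_union hx hdis hw ha hbn
    fun v hv => by simpa using hb (fun i => v (.inl i)) fun i => hv _
  rw [hun] at h
  exact ⟨m, hm, fun i => u (.inr i), fun i => hu _, fun v hv => by simpa using h v hv⟩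

theorem exists_pureValue_stage [CharZero k] (hx : AlgebraicIndependent k₀ x) {s : List k} {b : k}
    {n : ℕ} (hbn : b ∈ stage k₀ x n)
    (hb : ∀ v, (∀ i, v i ∈ stage k₀ x n) → listPfister s v ≠ b) (r : List k)
    (hrs : ∀ a ∈ r ++ s, a ∈ stage k₀ x n) (ha : (listPfister (r ++ s)).Anisotropic) :
    ∃ m, n ≤ m ∧ ∃ c ∈ stage k₀ x m, PureValue s r c ∧
      ∀ v, (∀ i, v i ∈ stage k₀ x m) → listPfister (r ++ s) v ≠ b - c := by
  induction r with
  | nil => exact ⟨n, le_rfl, 0, zero_mem _, rfl, by simpa using hb⟩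
  | cons a r ih =>
    rw [List.cons_append, List.forall_mem_cons] at hrs
    obtain ⟨m, hm, c, hc, hpc, h⟩ := ih hrs.2 ((listPfister_cons _ _).anisotropic ha).of_double
    have hw : ∀ i, pfisterWeight (a :: (r ++ s)) i ∈ stage k₀ x m := fun i =>
      pfisterWeight_mem (F := (stage k₀ x m).toSubfield)
        (List.forall_mem_cons.2 ⟨stage_mono hm hrs.1, fun y hy => stage_mono hm (hrs.2 y hy)⟩) i
    obtain ⟨m', hm', u, hu, h'⟩ := exists_not_represents_sumElim hx
      (ι := PfisterIndex (r ++ s)) (κ := PfisterIndex (r ++ s)) hw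
      (anisotropic_listPfister_iff.1 ha)
      (sub_mem (stage_mono hm hbn) hc) fun v hv => by
        have := h v hv
        rwa [listPfister_apply] at this
    refine ⟨m', hm.trans hm', c + a * listPfister (r ++ s) u, ?_, ⟨c, u, hpc, rfl⟩, fun v hv => ?_⟩
    · rw [listPfister_apply]
      refine add_mem (stage_mono hm' hc) (mul_mem (stage_mono (hm.trans hm') hrs.1)
        (sum_mem fun i _ => mul_mem ?_ (pow_mem (hu i) 2)))
      exact stage_mono hm' (hw (Sum.inl i))
    · refine (listPfister_apply _ _).trans_ne ((h' v hv).trans_eq ?_)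
      rw [listPfister_apply, Finset.mul_sum, sub_add_eq_sub_sub, sub_eq_add_neg _ (Finset.sum _ _),
        ← Finset.sum_neg_distrib]
      refine congrArg (b - c + ·) (Finset.sum_congr rfl fun i _ => ?_)
      simp only [pfisterWeight, Sum.elim_inr]
      ring

theorem exists_pureValue [CharZero k] (hx : AlgebraicIndependent k₀ x)
    (htop : adjoin k₀ (Set.range x) = ⊤) {s r : List k} {b : k} (hb : ∀ v, listPfister s v ≠ b)
    (ha : (listPfister (r ++ s)).Anisotropic) :
    ∃ c, PureValue s r c ∧ ∀ v, listPfister (r ++ s) v ≠ b - c := by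
  obtain ⟨n, hn⟩ := exists_forall_mem_stage htop (b :: (r ++ s)).get
  replace hn : ∀ y ∈ b :: (r ++ s), y ∈ stage k₀ x n := fun y hy => by
    obtain ⟨i, rfl⟩ := List.get_of_mem hy
    exact hn i
  rw [List.forall_mem_cons] at hn
  obtain ⟨m, hm, c, hc, hpc, h⟩ := exists_pureValue_stage hx hn.1 (fun v _ => hb v) r hn.2 ha
  refine ⟨c, hpc, fun v hv => ?_⟩
  set w : Option (PfisterIndex (r ++ s)) → k := fun i => i.elim (-(b - c)) (pfisterWeight (r ++ s))
  have hwm : ∀ i, pfisterWeight (r ++ s) i ∈ stage k₀ x m := fun i =>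
    pfisterWeight_mem (F := (stage k₀ x m).toSubfield) (fun y hy => stage_mono hm (hn.2 y hy)) i
  have hw : DiagAnisotropic Finset.univ w := by
    refine diagAnisotropic_of_stage (n := m) hx htop ?_ ?_
    · rintro (_ | i)
      · exact neg_mem (sub_mem (stage_mono hm hn.1) hc)
      · exact hwm i
    · intro u hu h0
      rw [Fintype.sum_option] at h0
      simp only [w, Option.elim] at h0
      have hnone : u none = 0 := by
        by_contra hne
        refine h (fun i => u (some i) / u none) (fun i => div_mem (hu _) (hu _)) ?_
        rw [listPfister_apply]
        simp only [div_pow, ← mul_div_assoc]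
        rw [← Finset.sum_div, div_eq_iff (pow_ne_zero 2 hne)]
        linear_combination h0
      rw [hnone] at h0
      have hsome := anisotropic_listPfister_iff.1 ha (fun i => u (some i)) (by simpa using h0)
      rintro (_ | i) _
      · exact hnone
      · exact hsome i (Finset.mem_univ _)
  have := hw (fun i => i.elim 1 v) (by
    rw [Fintype.sum_option]
    simp only [w, Option.elim]
    rw [← listPfister_apply, hv]
    ring) none (Finset.mem_univ _)
  exact one_ne_zero this

theorem exists_common_multiple [CharZero k] (hx : AlgebraicIndependent k₀ x)
    (htop : adjoin k₀ (Set.range x) = ⊤) {l : List k} (hl : (0 : k) ∉ l)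
    (hla : (listPfister l).Anisotropic) {s : List k} (hs : (0 : k) ∉ s)
    (hsa : (listPfister s).Anisotropic) :
    ∃ r q : List k, (0 : k) ∉ r ∧ (0 : k) ∉ q ∧
      (listPfister (r ++ s)).Equivalent (listPfister (q ++ l)) ∧
      (listPfister (r ++ s)).Anisotropic := by
  induction s with
  | nil =>
    exact ⟨l, [], hl, List.not_mem_nil, listPfister_perm (by simp),
      (listPfister_perm (by simp)).anisotropic hla⟩
  | cons b s ih =>
    rw [List.mem_cons, not_or] at hs
    have hsd := (listPfister_cons b s).anisotropic hsa
    obtain ⟨r, q, hr, hq, he, ha⟩ := ih hs.2 hsd.of_double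
    have hb : ∀ v, listPfister s v ≠ b :=
      hsd.ne_of_double (exists_listPfister_eq_one s).choose_spec
    obtain ⟨c, hc, hcv⟩ := exists_pureValue hx htop hb ha
    have ht : b - c ≠ 0 := fun h0 => hcv 0 (by rw [h0, QuadraticMap.map_zero])
    have hrs : (0 : k) ∉ r ++ s := by simp [hr, hs.2]
    have ha' : (listPfister ((b - c) :: (r ++ s))).Anisotropic :=
      (listPfister_cons _ _).symm.anisotropic ((isRound_listPfister hrs).anisotropic_double ha hcv)
    obtain ⟨v, hv⟩ := exists_listPfister_eq_one (r ++ s)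
    have hpv : PureValue s ((b - c) :: r) b := ⟨c, v, hc, by rw [hv]; ring⟩
    obtain ⟨r', hr', he'⟩ := hpv.exists_equivalent hs.2 (by simp [hr, ht.symm]) (Ne.symm hs.1)
    exact ⟨r', (b - c) :: q, hr', by simp [hq, ht.symm],
      he'.symm.trans (listPfister_cons_congr _ he), he'.anisotropic ha'⟩

theorem exists_common_multiple_finite [CharZero k] (hx : AlgebraicIndependent k₀ x)
    (htop : adjoin k₀ (Set.range x) = ⊤) {n : ℕ} (l : Fin n → List k) (hl : ∀ i, (0 : k) ∉ l i)
    (hla : ∀ i, (listPfister (l i)).Anisotropic) :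
    ∃ m : List k, (0 : k) ∉ m ∧ (listPfister m).Anisotropic ∧
      ∀ i, ∃ c : List k, (0 : k) ∉ c ∧
        (listPfister m).Equivalent (listPfister (c ++ l i)) := by
  induction n with
  | zero =>
    refine ⟨[], List.not_mem_nil, ?_, fun i => i.elim0⟩
    intro v hv
    rw [listPfister_nil_apply] at hv
    exact funext fun _ => (pow_eq_zero_iff two_ne_zero).1 hv
  | succ n ih =>
    obtain ⟨m, hm, hma, h⟩ := ih (fun i => l i.succ) (fun i => hl _) fun i => hla _
    obtain ⟨r, q, hr, hq, he, ha⟩ := exists_common_multiple hx htop hm hma (hl 0) (hla 0)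
    refine ⟨r ++ l 0, by simp [hr, hl], ha, Fin.cases ⟨r, hr, Equivalent.refl _⟩ fun i => ?_⟩
    obtain ⟨c, hc, hec⟩ := h i
    refine ⟨q ++ c, by simp [hq, hc], he.trans ?_⟩
    clear he
    induction q with
    | nil => exact hec
    | cons a q ihq => exact listPfister_cons_congr a (ihq (fun h => hq (List.mem_cons_of_mem _ h)))

end CommonMultiple

section Comparison

open QuadraticMap

variable {k : Type*} [Field k] {ι κ : Type*} [Fintype ι] [Fintype κ]

theorem equivalent_weightedSumSquares_of_equiv (e : ι ≃ κ) {w : ι → k} {w' : κ → k}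
    (h : ∀ i, w i = w' (e i)) :
    (weightedSumSquares k w).Equivalent (weightedSumSquares k w') := by
  refine ⟨{ LinearEquiv.funCongrLeft k k e.symm with map_app' := fun v => ?_ }⟩
  rw [weightedSumSquares_apply, weightedSumSquares_apply]
  refine (Fintype.sum_equiv e _ _ fun i => ?_).symm
  simp [h, LinearEquiv.funCongrLeft, LinearMap.funLeft]

theorem associated_weightedSumSquares_single [Invertible (2 : k)] [DecidableEq ι] (w : ι → k)
    {i j : ι} (h : i ≠ j) :
    (associated (R := k) (weightedSumSquares k w)) (Pi.single i 1) (Pi.single j 1) = 0 := by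
  rw [associated_apply]
  simp only [weightedSumSquares_apply, Pi.add_apply]
  rw [← Finset.sum_sub_distrib, ← Finset.sum_sub_distrib, Finset.sum_eq_zero, smul_zero]
  intro l _
  by_cases hi : l = i
  · subst hi
    simp [Pi.single_eq_of_ne h]
  · simp [Pi.single_eq_of_ne hi]

theorem equivalent_tmul_weightedSumSquares [Invertible (2 : k)] (w : ι → k) (w' : κ → k) :
    (QuadraticForm.tmul (weightedSumSquares k w) (weightedSumSquares k w')).Equivalent
      (weightedSumSquares k fun p : ι × κ => w p.1 * w' p.2) := by
  classical
  set Q := QuadraticForm.tmul (weightedSumSquares k w) (weightedSumSquares k w')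
  set B := (Pi.basisFun k ι).tensorProduct (Pi.basisFun k κ)
  have hB : (associated (R := k) Q).IsOrthoᵢ B := by
    rintro ⟨i, j⟩ ⟨i', j'⟩ hne
    simp only [Function.onFun, B, Q, Module.Basis.tensorProduct_apply,
      Pi.basisFun_apply]
    rw [QuadraticForm.associated_tmul, LinearMap.BilinForm.tensorDistrib_tmul, smul_eq_mul]
    by_cases hi : i = i'
    · rw [associated_weightedSumSquares_single w' (fun hj => hne (Prod.ext hi hj)), zero_mul]
    · rw [associated_weightedSumSquares_single w hi, mul_zero]
  have hQB : (fun p => Q (B p)) = fun p : ι × κ => w p.1 * w' p.2 := by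
    ext ⟨i, j⟩
    simp only [Q, B, Module.Basis.tensorProduct_apply, Pi.basisFun_apply,
      QuadraticForm.tensorDistrib_tmul]
    simp [weightedSumSquares_apply, Pi.single_apply, mul_comm]
  have hQ : Q.Equivalent (Q.basisRepr B) := ⟨Q.isometryEquivBasisRepr B⟩
  rwa [basisRepr_eq_of_iIsOrtho Q B hB, hQB] at hQ

theorem QuadraticMap.Equivalent.tmul [Invertible (2 : k)] {M₁ M₂ M₃ M₄ : Type*}
    [AddCommGroup M₁] [Module k M₁] [AddCommGroup M₂] [Module k M₂] [AddCommGroup M₃] [Module k M₃]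
    [AddCommGroup M₄] [Module k M₄] {Q₁ : QuadraticForm k M₁} {Q₂ : QuadraticForm k M₂}
    {Q₃ : QuadraticForm k M₃} {Q₄ : QuadraticForm k M₄} (h : Q₁.Equivalent Q₂)
    (h' : Q₃.Equivalent Q₄) :
    (QuadraticForm.tmul Q₁ Q₃).Equivalent (QuadraticForm.tmul Q₂ Q₄) := by
  obtain ⟨e⟩ := h
  obtain ⟨e'⟩ := h'
  exact ⟨{
    TensorProduct.congr e.toLinearEquiv e'.toLinearEquiv with
    map_app' := QuadraticForm.tmul_tensorMap_apply e.toIsometry e'.toIsometry }⟩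

theorem exists_pfisterIndex_append_equiv (r s : List k) :
    ∃ e : PfisterIndex (r ++ s) ≃ PfisterIndex r × PfisterIndex s,
      ∀ i, pfisterWeight (r ++ s) i = pfisterWeight r (e i).1 * pfisterWeight s (e i).2 := by
  induction r with
  | nil =>
    exact ⟨(Equiv.punitProd (PfisterIndex s)).symm, fun i => (one_mul _).symm⟩
  | cons a r ih =>
    obtain ⟨e, he⟩ := ih
    refine ⟨(Equiv.sumCongr e e).trans (Equiv.sumProdDistrib _ _ _).symm, ?_⟩
    rintro (i | i)
    · exact he i
    · exact (congrArg (-a * ·) (he i)).trans (mul_assoc _ _ _).symm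

theorem listPfister_append (r s : List k) [Invertible (2 : k)] :
    (listPfister (r ++ s)).Equivalent (QuadraticForm.tmul (listPfister r) (listPfister s)) := by
  obtain ⟨e, he⟩ := exists_pfisterIndex_append_equiv r s
  exact (equivalent_weightedSumSquares_of_equiv e he).trans
    (equivalent_tmul_weightedSumSquares _ _).symm

theorem exists_finset_equiv_pfisterIndex {n : ℕ} (a : Fin n → k) :
    ∃ e : PfisterIndex (List.ofFn a) ≃ Finset (Fin n),
      ∀ i, pfisterWeight (List.ofFn a) i = ∏ j ∈ e i, -a j := by
  induction n with
  | zero =>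
    rw [List.ofFn_zero]
    exact ⟨Equiv.ofUnique Unit _, fun i => Finset.prod_empty.symm⟩
  | succ n ih =>
    obtain ⟨e, he⟩ := ih fun i => a i.succ
    rw [List.ofFn_succ]
    have h0 : ∀ i, 0 ∉ (e i).map (Fin.succEmb n) := fun i => by simp [Fin.succ_ne_zero]
    set f : PfisterIndex (a 0 :: List.ofFn fun i => a i.succ) → Finset (Fin (n + 1)) :=
      Sum.elim (fun i => (e i).map (Fin.succEmb n))
        fun i => Finset.cons 0 ((e i).map (Fin.succEmb n)) (h0 i) with hf
    have hinj : Function.Injective f := by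
      rintro (i | i) (j | j) hij <;> simp only [hf, Sum.elim_inl, Sum.elim_inr] at hij
      · rw [Finset.map_inj, e.apply_eq_iff_eq] at hij
        rw [hij]
      · exact absurd (hij ▸ Finset.mem_cons_self _ _) (h0 i)
      · exact absurd (hij.symm ▸ Finset.mem_cons_self _ _) (h0 j)
      · have := congrArg (Finset.erase · 0) hij
        simp only [Finset.erase_cons] at this
        rw [Finset.map_inj, e.apply_eq_iff_eq] at this
        rw [this]
    have hcard : Fintype.card (PfisterIndex (a 0 :: List.ofFn fun i => a i.succ)) =
        Fintype.card (Finset (Fin (n + 1))) := by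
      refine (Fintype.card_sum (α := PfisterIndex (List.ofFn fun i => a i.succ))
        (β := PfisterIndex (List.ofFn fun i => a i.succ))).trans ?_
      rw [Fintype.card_congr e, Fintype.card_finset, Fintype.card_finset, Fintype.card_fin,
        Fintype.card_fin, pow_succ, mul_two]
    refine ⟨Equiv.ofBijective f ((Fintype.bijective_iff_injective_and_card f).2 ⟨hinj, hcard⟩), ?_⟩
    rintro (i | i)
    · refine (he i).trans ?_
      exact (Finset.prod_map (e i) (Fin.succEmb n) fun j => -a j).symm
    · refine (congrArg (-a 0 * ·) (he i)).trans ?_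
      refine Eq.trans ?_ (Finset.prod_cons (f := fun j => -a j) (h0 i)).symm
      exact congrArg (-a 0 * ·) (Finset.prod_map (e i) (Fin.succEmb n) fun j => -a j).symm

theorem listPfister_ofFn {k : Type u} [Field k] {n : ℕ} (a : Fin n → k) :
    (listPfister (List.ofFn a)).Equivalent (PfisterForm k a) := by
  obtain ⟨e, he⟩ := exists_finset_equiv_pfisterIndex a
  exact equivalent_weightedSumSquares_of_equiv e he

end Comparison

theorem IsFlexible.exists_adjoin_eq_top {k : Type u} [Field k] (hk : IsFlexible k) :
    ∃ (k₀ : Type u) (_ : Field k₀) (_ : Algebra k₀ k) (x : ℕ → k),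
      AlgebraicIndependent k₀ x ∧ IntermediateField.adjoin k₀ (Set.range x) = ⊤ := by
  obtain ⟨k₀, e⟩ := hk
  set f : MvPolynomial ℕ k₀ →+* k :=
    (e.symm : FractionRing (MvPolynomial ℕ k₀) →+* k).comp (algebraMap _ _)
  let _ : Algebra k₀ k := (f.comp MvPolynomial.C).toAlgebra
  set x : ℕ → k := fun i => f (MvPolynomial.X i)
  have hfx : ∀ p, MvPolynomial.aeval x p = f p := fun p => by
    refine DFunLike.congr_fun (f := (MvPolynomial.aeval x).toRingHom) (g := f) ?_ p
    refine MvPolynomial.ringHom_ext (fun c => ?_) fun i => ?_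
    · exact MvPolynomial.aeval_C x c
    · exact MvPolynomial.aeval_X x i
  refine ⟨k₀, inferInstance, inferInstance, x, ?_, ?_⟩
  · rw [algebraicIndependent_iff_injective_aeval]
    intro p q hpq
    rw [hfx, hfx] at hpq
    exact IsFractionRing.injective _ _ (e.symm.injective hpq)
  · refine eq_top_iff.2 fun y _ => ?_
    obtain ⟨p, q, -, hpq⟩ := IsFractionRing.div_surjective (A := MvPolynomial ℕ k₀) (e y)
    have hy : y = MvPolynomial.aeval x p / MvPolynomial.aeval x q := by
      rw [hfx, hfx, ← e.symm_apply_apply y, ← hpq, map_div₀]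
      rfl
    have hmem : ∀ p, MvPolynomial.aeval x p ∈ IntermediateField.adjoin k₀ (Set.range x) :=
      fun p => IntermediateField.algebra_adjoin_le_adjoin _ _
        ((Algebra.adjoin_range_eq_range_aeval k₀ x).ge ⟨p, rfl⟩)
    rw [hy]
    exact div_mem (hmem p) (hmem q)

/-- Over a flexible field of characteristic zero, any finite collection of anisotropic Pfister
forms has a common "multiple": an anisotropic Pfister form `π` such that each `π_l` divides `π`,
i.e. `π ≅ π_l ⊗ τ_l` for some Pfister form `τ_l`. -/
theorem common_multiple_of_anisotropic_pfister_forms_of_flexible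
    {k : Type u} [Field k] [CharZero k] (hk : IsFlexible k)
    (s : ℕ) (r : Fin s → ℕ) (a : (l : Fin s) → Fin (r l) → k)
    (ha : ∀ l i, a l i ≠ 0)
    (hanis : ∀ l, QuadraticMap.Anisotropic (PfisterForm k (a l))) :
    ∃ (t : ℕ) (b : Fin t → k), (∀ i, b i ≠ 0) ∧
      QuadraticMap.Anisotropic (PfisterForm k b) ∧
      ∀ l, ∃ (t' : ℕ) (c : Fin t' → k), (∀ i, c i ≠ 0) ∧
        Nonempty (QuadraticMap.IsometryEquiv (PfisterForm k b)
          (QuadraticForm.tmul (PfisterForm k (a l)) (PfisterForm k c))) := by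
  obtain ⟨k₀, _, _, x, hx, htop⟩ := hk.exists_adjoin_eq_top
  obtain ⟨m, hm, hma, h⟩ := exists_common_multiple_finite hx htop (fun l => List.ofFn (a l))
    (fun l h0 => by
      obtain ⟨i, hi⟩ := (List.mem_ofFn' _ _).1 h0
      exact ha l i hi)
    fun l => (listPfister_ofFn (a l)).symm.anisotropic (hanis l)
  have hofFn : ∀ m : List k, (listPfister m).Equivalent (PfisterForm k m.get) := fun m => by
    have := listPfister_ofFn m.get
    rwa [List.ofFn_get] at this
  have hne : ∀ m : List k, (0 : k) ∉ m → ∀ i, m.get i ≠ 0 := fun m hm i h0 =>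
    hm (h0 ▸ m.get_mem i)
  refine ⟨m.length, m.get, hne m hm, (hofFn m).anisotropic hma, fun l => ?_⟩
  obtain ⟨c, hc, he⟩ := h l
  refine ⟨c.length, c.get, hne c hc, ?_⟩
  exact (((hofFn m).symm.trans he).trans (listPfister_perm List.perm_append_comm)).trans
    ((listPfister_append _ _).trans ((listPfister_ofFn (a l)).tmul (hofFn c)))
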